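/- arXiv:1901.10640 — 2 statements merged into one kernel-verified Lean document; each statement's English description precedes it below -/
import Mathlib

section
/- Let E be a finite-dimensional COSEA that is state-unique and symmetric (i.e. â(b)=b̂(a) for all a,b∈S_1(E)). Then any two contexts of E have the same cardinality. -/
set_option linter.unusedVariables false

universe u v

theorem prod_eq' {α β : Type*} {p q : α × β} (h1 : p.1 = q.1) (h2 : p.2 = q.2) : p = q :=
  Prod.ext_iff.mpr ⟨h1, h2⟩

/-- A convex sequential effect algebra (COSEA).  The partial sum `⊕` is modelled by a
total operation `oplus` together with a definedness predicate `perp`; all axioms only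
constrain `oplus` on pairs satisfying `perp`.  The scalar action is modelled by a total
map `smul : ℝ → E → E`, with axioms imposed for scalars in `[0,1]`. -/
structure COSEA (E : Type u) where
  zero : E
  one : E
  perp : E → E → Prop
  oplus : E → E → E
  compl : E → E
  smul : ℝ → E → E
  seq : E → E → E
  -- effect algebra axioms
  perp_comm : ∀ a b, perp a b → perp b a
  oplus_comm : ∀ a b, perp a b → oplus a b = oplus b a
  perp_assoc_right : ∀ a b c, perp a b → perp (oplus a b) c → perp b c
  perp_assoc_left : ∀ a b c, perp a b → perp (oplus a b) c → perp a (oplus b c)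
  oplus_assoc : ∀ a b c, perp a b → perp (oplus a b) c →
    oplus a (oplus b c) = oplus (oplus a b) c
  perp_compl : ∀ a, perp a (compl a)
  oplus_compl : ∀ a, oplus a (compl a) = one
  compl_unique : ∀ a b, perp a b → oplus a b = one → b = compl a
  perp_one : ∀ a, perp a one → a = zero
  -- convexity axioms
  smul_smul : ∀ α β a, 0 ≤ α → α ≤ 1 → 0 ≤ β → β ≤ 1 →
    smul α (smul β a) = smul (α * β) a
  perp_smul_self : ∀ α β a, 0 ≤ α → 0 ≤ β → α + β ≤ 1 → perp (smul α a) (smul β a)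
  add_smul : ∀ α β a, 0 ≤ α → 0 ≤ β → α + β ≤ 1 →
    smul (α + β) a = oplus (smul α a) (smul β a)
  perp_smul : ∀ lam a b, 0 ≤ lam → lam ≤ 1 → perp a b → perp (smul lam a) (smul lam b)
  smul_oplus : ∀ lam a b, 0 ≤ lam → lam ≤ 1 → perp a b →
    smul lam (oplus a b) = oplus (smul lam a) (smul lam b)
  one_smul : ∀ a, smul 1 a = a
  -- sequential product axioms
  seq_perp : ∀ a b c, perp b c → perp (seq a b) (seq a c)
  seq_oplus : ∀ a b c, perp b c → seq a (oplus b c) = oplus (seq a b) (seq a c)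
  one_seq : ∀ a, seq one a = a
  seq_eq_zero_comm : ∀ a b, seq a b = zero → seq b a = seq a b
  comm_compl : ∀ a b, seq a b = seq b a → seq a (compl b) = seq (compl b) a
  comm_assoc : ∀ a b c, seq a b = seq b a → seq a (seq b c) = seq (seq a b) c
  comm_seq : ∀ a b c, seq c a = seq a c → seq c b = seq b c →
    seq c (seq a b) = seq (seq a b) c
  comm_oplus : ∀ a b c, seq c a = seq a c → seq c b = seq b c → perp a b →
    seq c (oplus a b) = seq (oplus a b) c
  smul_seq : ∀ lam a b, 0 ≤ lam → lam ≤ 1 → seq (smul lam a) b = smul lam (seq a b)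
  seq_smul : ∀ lam a b, 0 ≤ lam → lam ≤ 1 → seq a (smul lam b) = smul lam (seq a b)

/-- `SumList C l s` : the orthogonal sum of the list `l` is defined and equals `s`. -/
inductive COSEA.SumList {E : Type u} (C : COSEA E) : List E → E → Prop
  | nil : COSEA.SumList C [] C.zero
  | cons {a : E} {l : List E} {s : E} :
      COSEA.SumList C l s → C.perp a s → COSEA.SumList C (a :: l) (C.oplus a s)

namespace COSEA

variable {E : Type u}

/-- `a ≤ b` in the effect-algebra order. -/
def le (C : COSEA E) (a b : E) : Prop := ∃ c, C.perp a c ∧ C.oplus a c = b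

/-- `a` is sharp: the greatest lower bound of `a` and `a'` is `0`,
i.e. every common lower bound of `a` and `a'` lies below `0`. -/
def IsSharp (C : COSEA E) (a : E) : Prop :=
  ∀ c, C.le c a → C.le c (C.compl a) → C.le c C.zero

/-- `a` is a one-dimensional (atomic) sharp element. -/
def IsOneDim (C : COSEA E) (a : E) : Prop :=
  C.IsSharp a ∧ a ≠ C.zero ∧
    ∀ b, C.le b a → ∃ lam : ℝ, 0 ≤ lam ∧ lam ≤ 1 ∧ b = C.smul lam a

/-- A state on a COSEA. -/
def IsState (C : COSEA E) (ω : E → ℝ) : Prop :=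
  (∀ a, 0 ≤ ω a ∧ ω a ≤ 1) ∧ ω C.one = 1 ∧
    ∀ a b, C.perp a b → ω (C.oplus a b) = ω a + ω b

/-- A context presented as an injective finite enumeration of one-dimensional
elements summing to `1`. -/
def IsContextFun (C : COSEA E) {n : ℕ} (a : Fin n → E) : Prop :=
  Function.Injective a ∧ (∀ i, C.IsOneDim (a i)) ∧ C.SumList (List.ofFn a) C.one

/-- A context as a set of effects. -/
def IsContext (C : COSEA E) (A : Set E) : Prop :=
  ∃ (n : ℕ) (a : Fin n → E), C.IsContextFun a ∧ Set.range a = A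

/-- `E` is finite-dimensional: there is no infinite sequence of one-dimensional
elements all of whose initial partial orthogonal sums are defined. -/
def FinDim (C : COSEA E) : Prop :=
  ¬ ∃ f : ℕ → E, (∀ i, C.IsOneDim (f i)) ∧
      ∀ n : ℕ, ∃ s, C.SumList ((List.range n).map f) s

/-- `E` is state-unique. -/
def StateUnique (C : COSEA E) : Prop :=
  ∀ a, C.IsOneDim a → ∃! ω : E → ℝ, C.IsState ω ∧ ω a = 1

/-- `E` is symmetric : `â(b) = b̂(a)` for all one-dimensional `a, b`. -/
def Symm (C : COSEA E) : Prop :=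
  ∀ a b ω ρ, C.IsOneDim a → C.IsOneDim b → C.IsState ω → C.IsState ρ →
    ω a = 1 → ρ b = 1 → ω b = ρ a

/-- `b = λ₁ a₁ ⊕ ⋯ ⊕ λₙ aₙ` with all `λ i ∈ [0,1]`. -/
def SpanRep (C : COSEA E) {n : ℕ} (a : Fin n → E) (lam : Fin n → ℝ) (b : E) : Prop :=
  (∀ i, 0 ≤ lam i ∧ lam i ≤ 1) ∧
    C.SumList (List.ofFn fun i => C.smul (lam i) (a i)) b

/-- `b ∈ E(A)` : `b` has a representation over the context `A`. -/
def InSpan (C : COSEA E) (A : Set E) (b : E) : Prop :=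
  ∃ (n : ℕ) (a : Fin n → E) (lam : Fin n → ℝ),
    C.IsContextFun a ∧ Set.range a = A ∧ C.SpanRep a lam b

/-- `E` is spectral. -/
def Spectral (C : COSEA E) : Prop :=
  C.StateUnique ∧ ∀ b, ∃ A, C.IsContext A ∧ C.InSpan A b

/-- The commutant of a subset. -/
def commutant (C : COSEA E) (F : Set E) : Set E :=
  {b | ∀ a ∈ F, C.seq b a = C.seq a b}

/-- The center `E' = {b : b ∘ a = a ∘ b for all a}`. -/
def center (C : COSEA E) : Set E := C.commutant Set.univ

/-- `E` is a factor: the center consists of the effects `λ 1`, `λ ∈ [0,1]`. -/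
def IsFactor (C : COSEA E) : Prop :=
  C.center = {b | ∃ lam : ℝ, 0 ≤ lam ∧ lam ≤ 1 ∧ b = C.smul lam C.one}

/-- Sub-COSEA. -/
def IsSubCOSEA (C : COSEA E) (F : Set E) : Prop :=
  C.zero ∈ F ∧ C.one ∈ F ∧ (∀ a ∈ F, C.compl a ∈ F) ∧
    (∀ lam : ℝ, 0 ≤ lam → lam ≤ 1 → ∀ a ∈ F, C.smul lam a ∈ F) ∧
    (∀ a ∈ F, ∀ b ∈ F, C.perp a b → C.oplus a b ∈ F) ∧
    (∀ a ∈ F, ∀ b ∈ F, C.seq a b ∈ F)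

/-- `a` is a minimal sharp element of `F`. -/
def MinSharp (C : COSEA E) (F : Set E) (a : E) : Prop :=
  a ∈ F ∧ C.IsSharp a ∧ a ≠ C.zero ∧
    ∀ b ∈ F, C.IsSharp b → b ≠ C.zero → C.le b a → b = a

/-- COSEA isomorphism. -/
def IsIso {F : Type u} (C : COSEA E) (D : COSEA F) (φ : E → F) : Prop :=
  Function.Bijective φ ∧ φ C.one = D.one ∧
    (∀ a b, C.perp a b ↔ D.perp (φ a) (φ b)) ∧
    (∀ a b, C.perp a b → φ (C.oplus a b) = D.oplus (φ a) (φ b)) ∧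
    (∀ lam : ℝ, 0 ≤ lam → lam ≤ 1 → ∀ a, φ (C.smul lam a) = D.smul lam (φ a)) ∧
    (∀ a b, φ (C.seq a b) = D.seq (φ a) (φ b))

/-- `lam` is an eigenvalue of `b` : `lam = â(b)` for some eigeneffect `a` of `b`. -/
def IsEigenvalue (C : COSEA E) (b : E) (lam : ℝ) : Prop :=
  ∃ (a : E) (ω : E → ℝ), C.IsOneDim a ∧ C.seq a b = C.seq b a ∧
    C.IsState ω ∧ ω a = 1 ∧ lam = ω b

/-- The spectrum of `b`. -/
def spectrum (C : COSEA E) (b : E) : Set ℝ := {lam | C.IsEigenvalue b lam}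

/-- `c = ⌈a⌉` : `c` is the least sharp element dominating `a`. -/
def IsCeil (C : COSEA E) (a c : E) : Prop :=
  C.IsSharp c ∧ C.le a c ∧ ∀ d, C.IsSharp d → C.le a d → C.le c d

/-- `b` is a pseudo-inverse of `a` with scalar `lam` :
`⌈b⌉ = ⌈a⌉`, `‖b‖ = 1` and `a ∘ b = b ∘ a = lam ⌈a⌉`. -/
def IsPseudoInvWith (C : COSEA E) (a b : E) (lam : ℝ) : Prop :=
  (∃ ca, C.IsCeil a ca ∧ C.IsCeil b ca ∧
    C.seq a b = C.smul lam ca ∧ C.seq b a = C.smul lam ca) ∧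
  IsGreatest (C.spectrum b) 1 ∧ 0 ≤ lam ∧ lam ≤ 1

/-- The conditional probability map `γ_a` (zero functionals are sent to `0`). -/
noncomputable def condProb (C : COSEA E) (a : E) (ω : E → ℝ) : E → ℝ :=
  fun c => if ω a = 0 then 0 else ω (C.seq a c) / ω a

/-- Membership in `Ω̂(E) = Ω(E) ∪ {0}`. -/
def InOmegaHat (C : COSEA E) (ω : E → ℝ) : Prop :=
  C.IsState ω ∨ ω = fun _ => 0

/-- Direct sum of two COSEAs, with all operations componentwise. -/
def prod {E F : Type u} (C : COSEA E) (D : COSEA F) : COSEA (E × F) where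
  zero := (C.zero, D.zero)
  one := (C.one, D.one)
  perp a b := C.perp a.1 b.1 ∧ D.perp a.2 b.2
  oplus a b := (C.oplus a.1 b.1, D.oplus a.2 b.2)
  compl a := (C.compl a.1, D.compl a.2)
  smul lam a := (C.smul lam a.1, D.smul lam a.2)
  seq a b := (C.seq a.1 b.1, D.seq a.2 b.2)
  perp_comm := fun a b h => ⟨C.perp_comm _ _ h.1, D.perp_comm _ _ h.2⟩
  oplus_comm := fun a b h => prod_eq' (C.oplus_comm _ _ h.1) (D.oplus_comm _ _ h.2)
  perp_assoc_right := fun a b c h1 h2 =>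
    ⟨C.perp_assoc_right _ _ _ h1.1 h2.1, D.perp_assoc_right _ _ _ h1.2 h2.2⟩
  perp_assoc_left := fun a b c h1 h2 =>
    ⟨C.perp_assoc_left _ _ _ h1.1 h2.1, D.perp_assoc_left _ _ _ h1.2 h2.2⟩
  oplus_assoc := fun a b c h1 h2 =>
    prod_eq' (C.oplus_assoc _ _ _ h1.1 h2.1) (D.oplus_assoc _ _ _ h1.2 h2.2)
  perp_compl := fun a => ⟨C.perp_compl _, D.perp_compl _⟩
  oplus_compl := fun a => prod_eq' (C.oplus_compl _) (D.oplus_compl _)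
  compl_unique := fun a b h he =>
    prod_eq' (C.compl_unique _ _ h.1 (congrArg Prod.fst he))
      (D.compl_unique _ _ h.2 (congrArg Prod.snd he))
  perp_one := fun a h => prod_eq' (C.perp_one _ h.1) (D.perp_one _ h.2)
  smul_smul := fun α β a h1 h2 h3 h4 =>
    prod_eq' (C.smul_smul _ _ _ h1 h2 h3 h4) (D.smul_smul _ _ _ h1 h2 h3 h4)
  perp_smul_self := fun α β a h1 h2 h3 =>
    ⟨C.perp_smul_self _ _ _ h1 h2 h3, D.perp_smul_self _ _ _ h1 h2 h3⟩
  add_smul := fun α β a h1 h2 h3 =>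
    prod_eq' (C.add_smul _ _ _ h1 h2 h3) (D.add_smul _ _ _ h1 h2 h3)
  perp_smul := fun lam a b h1 h2 h =>
    ⟨C.perp_smul _ _ _ h1 h2 h.1, D.perp_smul _ _ _ h1 h2 h.2⟩
  smul_oplus := fun lam a b h1 h2 h =>
    prod_eq' (C.smul_oplus _ _ _ h1 h2 h.1) (D.smul_oplus _ _ _ h1 h2 h.2)
  one_smul := fun a => prod_eq' (C.one_smul _) (D.one_smul _)
  seq_perp := fun a b c h => ⟨C.seq_perp _ _ _ h.1, D.seq_perp _ _ _ h.2⟩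
  seq_oplus := fun a b c h => prod_eq' (C.seq_oplus _ _ _ h.1) (D.seq_oplus _ _ _ h.2)
  one_seq := fun a => prod_eq' (C.one_seq _) (D.one_seq _)
  seq_eq_zero_comm := fun a b h =>
    prod_eq' (C.seq_eq_zero_comm _ _ (congrArg Prod.fst h))
      (D.seq_eq_zero_comm _ _ (congrArg Prod.snd h))
  comm_compl := fun a b h =>
    prod_eq' (C.comm_compl _ _ (congrArg Prod.fst h))
      (D.comm_compl _ _ (congrArg Prod.snd h))
  comm_assoc := fun a b c h =>
    prod_eq' (C.comm_assoc _ _ _ (congrArg Prod.fst h))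
      (D.comm_assoc _ _ _ (congrArg Prod.snd h))
  comm_seq := fun a b c h1 h2 =>
    prod_eq' (C.comm_seq _ _ _ (congrArg Prod.fst h1) (congrArg Prod.fst h2))
      (D.comm_seq _ _ _ (congrArg Prod.snd h1) (congrArg Prod.snd h2))
  comm_oplus := fun a b c h1 h2 hp =>
    prod_eq' (C.comm_oplus _ _ _ (congrArg Prod.fst h1) (congrArg Prod.fst h2) hp.1)
      (D.comm_oplus _ _ _ (congrArg Prod.snd h1) (congrArg Prod.snd h2) hp.2)
  smul_seq := fun lam a b h1 h2 =>
    prod_eq' (C.smul_seq _ _ _ h1 h2) (D.smul_seq _ _ _ h1 h2)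
  seq_smul := fun lam a b h1 h2 =>
    prod_eq' (C.seq_smul _ _ _ h1 h2) (D.seq_smul _ _ _ h1 h2)

/-- Direct sum of a family of COSEAs, with all operations componentwise. -/
def pi {ι : Type v} {E : ι → Type u} (C : ∀ i, COSEA (E i)) : COSEA (∀ i, E i) where
  zero := fun i => (C i).zero
  one := fun i => (C i).one
  perp a b := ∀ i, (C i).perp (a i) (b i)
  oplus a b := fun i => (C i).oplus (a i) (b i)
  compl a := fun i => (C i).compl (a i)
  smul lam a := fun i => (C i).smul lam (a i)
  seq a b := fun i => (C i).seq (a i) (b i)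
  perp_comm := fun a b h i => (C i).perp_comm _ _ (h i)
  oplus_comm := fun a b h => funext fun i => (C i).oplus_comm _ _ (h i)
  perp_assoc_right := fun a b c h1 h2 i => (C i).perp_assoc_right _ _ _ (h1 i) (h2 i)
  perp_assoc_left := fun a b c h1 h2 i => (C i).perp_assoc_left _ _ _ (h1 i) (h2 i)
  oplus_assoc := fun a b c h1 h2 => funext fun i => (C i).oplus_assoc _ _ _ (h1 i) (h2 i)
  perp_compl := fun a i => (C i).perp_compl _
  oplus_compl := fun a => funext fun i => (C i).oplus_compl _
  compl_unique := fun a b h he =>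
    funext fun i => (C i).compl_unique _ _ (h i) (congrFun he i)
  perp_one := fun a h => funext fun i => (C i).perp_one _ (h i)
  smul_smul := fun α β a h1 h2 h3 h4 =>
    funext fun i => (C i).smul_smul _ _ _ h1 h2 h3 h4
  perp_smul_self := fun α β a h1 h2 h3 i => (C i).perp_smul_self _ _ _ h1 h2 h3
  add_smul := fun α β a h1 h2 h3 => funext fun i => (C i).add_smul _ _ _ h1 h2 h3
  perp_smul := fun lam a b h1 h2 h i => (C i).perp_smul _ _ _ h1 h2 (h i)
  smul_oplus := fun lam a b h1 h2 h =>
    funext fun i => (C i).smul_oplus _ _ _ h1 h2 (h i)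
  one_smul := fun a => funext fun i => (C i).one_smul _
  seq_perp := fun a b c h i => (C i).seq_perp _ _ _ (h i)
  seq_oplus := fun a b c h => funext fun i => (C i).seq_oplus _ _ _ (h i)
  one_seq := fun a => funext fun i => (C i).one_seq _
  seq_eq_zero_comm := fun a b h =>
    funext fun i => (C i).seq_eq_zero_comm _ _ (congrFun h i)
  comm_compl := fun a b h => funext fun i => (C i).comm_compl _ _ (congrFun h i)
  comm_assoc := fun a b c h => funext fun i => (C i).comm_assoc _ _ _ (congrFun h i)
  comm_seq := fun a b c h1 h2 =>
    funext fun i => (C i).comm_seq _ _ _ (congrFun h1 i) (congrFun h2 i)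
  comm_oplus := fun a b c h1 h2 hp =>
    funext fun i => (C i).comm_oplus _ _ _ (congrFun h1 i) (congrFun h2 i) (hp i)
  smul_seq := fun lam a b h1 h2 => funext fun i => (C i).smul_seq _ _ _ h1 h2
  seq_smul := fun lam a b h1 h2 => funext fun i => (C i).seq_smul _ _ _ h1 h2

end COSEA
namespace COSEA

theorem IsState.map_zero {E : Type u} {C : COSEA E} {ω : E → ℝ} (h : C.IsState ω) :
    ω C.zero = 0 := by
  have h0 : C.compl C.one = C.zero := C.perp_one _ (C.perp_comm _ _ (C.perp_compl _))
  have h1 := h.2.2 _ _ (C.perp_compl C.one)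
  rw [C.oplus_compl, h0] at h1
  linarith

/-- A state is additive on orthogonal sums of lists. -/
theorem IsState.map_sumList {E : Type u} {C : COSEA E} {ω : E → ℝ} (h : C.IsState ω)
    {l : List E} {s : E} (hs : C.SumList l s) : ω s = (l.map ω).sum := by
  induction hs with
  | nil => simpa using h.map_zero
  | cons _ hp ih => rw [h.2.2 _ _ hp, ih, List.map_cons, List.sum_cons]

/-- A state sums to `1` over a context. -/
theorem IsState.sum_contextFun {E : Type u} {C : COSEA E} {ω : E → ℝ} (h : C.IsState ω)
    {n : ℕ} {a : Fin n → E} (ha : C.IsContextFun a) : ∑ i, ω (a i) = 1 := by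
  rw [← h.2.1, h.map_sumList ha.2.2, List.map_ofFn, List.sum_ofFn]
  rfl

end COSEA

/-- In a finite-dimensional, state-unique, symmetric COSEA all
contexts have the same cardinality. -/
theorem contexts_same_card {E : Type u} (C : COSEA E)
    (hFD : C.FinDim) (hSU : C.StateUnique) (hSym : C.Symm) :
    ∀ A B : Set E, C.IsContext A → C.IsContext B → A.ncard = B.ncard := by
  rintro _ _ ⟨n, a, ha, rfl⟩ ⟨m, b, hb, rfl⟩
  choose α hα _ using fun i => hSU (a i) (ha.2.1 i)
  choose β hβ _ using fun j => hSU (b j) (hb.2.1 j)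
  have h : (n : ℝ) = m := calc
    (n : ℝ) = ∑ i, ∑ j, α i (b j) := by simp [fun i => (hα i).1.sum_contextFun hb]
    _ = ∑ j, ∑ i, β j (a i) := by
      rw [Finset.sum_comm]
      refine Finset.sum_congr rfl fun j _ => Finset.sum_congr rfl fun i _ => ?_
      exact hSym _ _ _ _ (ha.2.1 i) (hb.2.1 j) (hα i).1 (hβ j).1 (hα i).2 (hβ j).2
    _ = m := by simp [fun j => (hβ j).1.sum_contextFun ha]
  rw [Set.ncard_range_of_injective ha.1, Set.ncard_range_of_injective hb.1]
  simpa using h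
end

section
/- Let E=E1⊕E2 be the direct sum of two COSEAs. (i) (a_1,a_2)∈S_1(E) if and only if either a_1=0_1 and a_2∈S_1(E2), or a_2=0_2 and a_1∈S_1(E1). (ii) A subset A⊆E is a context of E if and only if A={(a_i,0_2)}∪{(0_1,b_j)} where {a_i} is a context of E1 and {b_j} is a context of E2. -/
set_option linter.unusedVariables false

universe u v

namespace COSEA

variable {E F : Type u}

theorem compl_eq_of_oplus_eq_one (C : COSEA E) {a b : E} (h : C.perp a b)
    (he : C.oplus a b = C.one) : a = C.compl b :=
  C.compl_unique _ _ (C.perp_comm _ _ h) ((C.oplus_comm _ _ h).symm.trans he)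

theorem compl_compl (C : COSEA E) (a : E) : C.compl (C.compl a) = a :=
  (C.compl_eq_of_oplus_eq_one (C.perp_compl a) (C.oplus_compl a)).symm

theorem compl_one (C : COSEA E) : C.compl C.one = C.zero :=
  C.perp_one _ (C.perp_comm _ _ (C.perp_compl _))

theorem perp_zero_and_oplus_zero (C : COSEA E) (a : E) :
    C.perp a C.zero ∧ C.oplus a C.zero = a := by
  have h1 : C.perp C.one C.zero := C.compl_one ▸ C.perp_compl C.one
  have h2 : C.oplus C.one C.zero = C.one := C.compl_one ▸ C.oplus_compl C.one
  have hp : C.perp (C.compl a) a := C.perp_comm _ _ (C.perp_compl a)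
  have hs : C.oplus (C.compl a) a = C.one :=
    (C.oplus_comm _ _ hp).trans (C.oplus_compl a)
  rw [← hs] at h1
  refine ⟨C.perp_assoc_right _ _ _ hp h1, ?_⟩
  have h3 := C.compl_unique _ _ (C.perp_assoc_left _ _ _ hp h1)
    (by rw [C.oplus_assoc _ _ _ hp h1, hs, h2])
  rw [h3, C.compl_compl]

theorem perp_zero (C : COSEA E) (a : E) : C.perp a C.zero :=
  (C.perp_zero_and_oplus_zero a).1

theorem oplus_zero (C : COSEA E) (a : E) : C.oplus a C.zero = a :=
  (C.perp_zero_and_oplus_zero a).2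

theorem zero_perp (C : COSEA E) (a : E) : C.perp C.zero a :=
  C.perp_comm _ _ (C.perp_zero a)

theorem zero_oplus (C : COSEA E) (a : E) : C.oplus C.zero a = a :=
  (C.oplus_comm _ _ (C.zero_perp a)).trans (C.oplus_zero a)

theorem oplus_right_cancel (C : COSEA E) {a b c : E} (hb : C.perp b a) (hc : C.perp c a)
    (h : C.oplus b a = C.oplus c a) : b = c := by
  have hpb := C.perp_compl (C.oplus b a)
  have hsb := C.oplus_compl (C.oplus b a)
  have hpc : C.perp (C.oplus c a) (C.compl (C.oplus b a)) := h ▸ hpb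
  have hsc : C.oplus (C.oplus c a) (C.compl (C.oplus b a)) = C.one := by rw [← h, hsb]
  rw [C.compl_eq_of_oplus_eq_one (C.perp_assoc_left _ _ _ hb hpb)
      ((C.oplus_assoc _ _ _ hb hpb).trans hsb),
    C.compl_eq_of_oplus_eq_one (C.perp_assoc_left _ _ _ hc hpc)
      ((C.oplus_assoc _ _ _ hc hpc).trans hsc)]

theorem le_refl (C : COSEA E) (a : E) : C.le a a := ⟨C.zero, C.perp_zero a, C.oplus_zero a⟩

theorem zero_le (C : COSEA E) (a : E) : C.le C.zero a := ⟨a, C.zero_perp a, C.zero_oplus a⟩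

theorem eq_zero_of_le_zero (C : COSEA E) {a : E} (h : C.le a C.zero) : a = C.zero := by
  obtain ⟨c, hp, hs⟩ := h
  have h1 : C.perp (C.oplus a c) C.one := hs ▸ C.zero_perp C.one
  have hc : c = C.zero := C.perp_one _ (C.perp_assoc_right _ _ _ hp h1)
  rwa [hc, C.oplus_zero] at hs

theorem zero_smul (C : COSEA E) (a : E) : C.smul 0 a = C.zero := by
  have hp := C.perp_smul_self 0 1 a le_rfl zero_le_one (by norm_num)
  have hs := C.add_smul 0 1 a le_rfl zero_le_one (by norm_num)
  rw [C.one_smul] at hp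
  rw [zero_add, C.one_smul] at hs
  exact C.oplus_right_cancel hp (C.zero_perp a) (by rw [← hs, C.zero_oplus])

theorem smul_zero (C : COSEA E) {r : ℝ} (h0 : 0 ≤ r) (h1 : r ≤ 1) :
    C.smul r C.zero = C.zero := by
  have hp := C.perp_smul r _ _ h0 h1 (C.zero_perp C.zero)
  have hs := C.smul_oplus r _ _ h0 h1 (C.zero_perp C.zero)
  rw [C.zero_oplus] at hs
  exact C.oplus_right_cancel hp (C.zero_perp _) (by rw [← hs, C.zero_oplus])

theorem smul_le_smul (C : COSEA E) (a : E) {r s : ℝ} (h0 : 0 ≤ r) (hrs : r ≤ s) (h1 : s ≤ 1) :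
    C.le (C.smul r a) (C.smul s a) := by
  refine ⟨C.smul (s - r) a, C.perp_smul_self _ _ _ h0 (by linarith) (by linarith), ?_⟩
  rw [← C.add_smul _ _ _ h0 (by linarith) (by linarith)]
  congr 1
  ring

theorem eq_zero_of_smul_eq_zero (C : COSEA E) {a : E} {r : ℝ} (h0 : 0 < r) (h1 : r ≤ 1)
    (h : C.smul r a = C.zero) : a = C.zero := by
  obtain ⟨n, hn⟩ := pow_unbounded_of_one_lt r⁻¹ (one_lt_two (α := ℝ))
  replace hn : 1 ≤ 2 ^ n * r := by
    have := mul_le_mul_of_nonneg_right hn.le h0.le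
    rwa [inv_mul_cancel₀ h0.ne'] at this
  induction n generalizing r with
  | zero =>
    obtain rfl : r = 1 := le_antisymm h1 (by simpa using hn)
    rwa [C.one_smul] at h
  | succ n ih =>
    have hm0 : 0 < min r (1 / 2) := lt_min h0 (by norm_num)
    have hm2 : min r (1 / 2) ≤ 1 / 2 := min_le_right _ _
    have hm : C.smul (min r (1 / 2)) a = C.zero :=
      C.eq_zero_of_le_zero (h ▸ C.smul_le_smul a hm0.le (min_le_left _ _) h1)
    refine ih (r := min r (1 / 2) + min r (1 / 2)) (by linarith) (by linarith) ?_ ?_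
    · rw [C.add_smul _ _ _ hm0.le hm0.le (by linarith), hm, C.zero_oplus]
    · rcases min_choice r (1 / 2) with he | he <;> rw [he]
      · rw [pow_succ] at hn
        linarith
      · have := one_le_pow₀ (one_le_two (α := ℝ)) (n := n)
        linarith

theorem isSharp_zero (C : COSEA E) : C.IsSharp C.zero := fun _ h _ => h

theorem prod_le_iff (C : COSEA E) (D : COSEA F) (a b : E × F) :
    (C.prod D).le a b ↔ C.le a.1 b.1 ∧ D.le a.2 b.2 := by
  constructor
  · rintro ⟨c, hp, hs⟩
    exact ⟨⟨c.1, hp.1, congrArg Prod.fst hs⟩, ⟨c.2, hp.2, congrArg Prod.snd hs⟩⟩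
  · rintro ⟨⟨c, hp, hs⟩, ⟨d, hp', hs'⟩⟩
    exact ⟨(c, d), ⟨hp, hp'⟩, Prod.ext hs hs'⟩

theorem prod_isSharp_iff (C : COSEA E) (D : COSEA F) (a : E × F) :
    (C.prod D).IsSharp a ↔ C.IsSharp a.1 ∧ D.IsSharp a.2 := by
  constructor
  · intro h
    refine ⟨fun c h1 h2 => ?_, fun c h1 h2 => ?_⟩
    · exact ((C.prod_le_iff D _ _).1 (h (c, D.zero)
        ((C.prod_le_iff D _ _).2 ⟨h1, D.zero_le _⟩)
        ((C.prod_le_iff D _ _).2 ⟨h2, D.zero_le _⟩))).1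
    · exact ((C.prod_le_iff D _ _).1 (h (C.zero, c)
        ((C.prod_le_iff D _ _).2 ⟨C.zero_le _, h1⟩)
        ((C.prod_le_iff D _ _).2 ⟨C.zero_le _, h2⟩))).2
  · rintro ⟨hC, hD⟩ c h1 h2
    rw [prod_le_iff] at h1 h2 ⊢
    exact ⟨hC _ h1.1 h2.1, hD _ h1.2 h2.2⟩

theorem IsOneDim.fst_eq_zero_or_snd_eq_zero {C : COSEA E} {D : COSEA F} {a : E × F}
    (h : (C.prod D).IsOneDim a) : a.1 = C.zero ∨ a.2 = D.zero := by
  obtain ⟨r, h0, h1, he⟩ := h.2.2 (a.1, D.zero)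
    ((C.prod_le_iff D _ _).2 ⟨C.le_refl _, D.zero_le _⟩)
  have he1 : a.1 = C.smul r a.1 := congrArg Prod.fst he
  have he2 : D.zero = D.smul r a.2 := congrArg Prod.snd he
  rcases h0.eq_or_lt with rfl | hr
  · exact .inl (he1.trans (C.zero_smul _))
  · exact .inr (D.eq_zero_of_smul_eq_zero hr h1 he2.symm)

theorem prod_isOneDim_zero_left_iff (C : COSEA E) (D : COSEA F) (a : F) :
    (C.prod D).IsOneDim (C.zero, a) ↔ D.IsOneDim a := by
  constructor
  · rintro ⟨hs, hne, hle⟩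
    refine ⟨((C.prod_isSharp_iff D _).1 hs).2, fun h => hne (Prod.ext rfl h), fun b hb => ?_⟩
    obtain ⟨r, h0, h1, he⟩ := hle (C.zero, b)
      ((C.prod_le_iff D _ _).2 ⟨C.le_refl _, hb⟩)
    exact ⟨r, h0, h1, congrArg Prod.snd he⟩
  · rintro ⟨hs, hne, hle⟩
    refine ⟨(C.prod_isSharp_iff D _).2 ⟨C.isSharp_zero, hs⟩,
      fun h => hne (congrArg Prod.snd h), fun b hb => ?_⟩
    rw [prod_le_iff] at hb
    obtain ⟨r, h0, h1, he⟩ := hle b.2 hb.2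
    exact ⟨r, h0, h1,
      Prod.ext ((C.eq_zero_of_le_zero hb.1).trans (C.smul_zero h0 h1).symm) he⟩

theorem prod_isOneDim_zero_right_iff (C : COSEA E) (D : COSEA F) (a : E) :
    (C.prod D).IsOneDim (a, D.zero) ↔ C.IsOneDim a := by
  constructor
  · rintro ⟨hs, hne, hle⟩
    refine ⟨((C.prod_isSharp_iff D _).1 hs).1, fun h => hne (Prod.ext h rfl), fun b hb => ?_⟩
    obtain ⟨r, h0, h1, he⟩ := hle (b, D.zero)
      ((C.prod_le_iff D _ _).2 ⟨hb, D.le_refl _⟩)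
    exact ⟨r, h0, h1, congrArg Prod.fst he⟩
  · rintro ⟨hs, hne, hle⟩
    refine ⟨(C.prod_isSharp_iff D _).2 ⟨hs, D.isSharp_zero⟩,
      fun h => hne (congrArg Prod.fst h), fun b hb => ?_⟩
    rw [prod_le_iff] at hb
    obtain ⟨r, h0, h1, he⟩ := hle b.1 hb.1
    exact ⟨r, h0, h1,
      Prod.ext he ((D.eq_zero_of_le_zero hb.2).trans (D.smul_zero h0 h1).symm)⟩

theorem prod_isOneDim_iff (C : COSEA E) (D : COSEA F) (a : E × F) :
    (C.prod D).IsOneDim a ↔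
      (a.1 = C.zero ∧ D.IsOneDim a.2) ∨ (a.2 = D.zero ∧ C.IsOneDim a.1) := by
  obtain ⟨x, y⟩ := a
  constructor
  · intro h
    rcases h.fst_eq_zero_or_snd_eq_zero with hx | hy
    · obtain rfl : x = C.zero := hx
      exact .inl ⟨rfl, (C.prod_isOneDim_zero_left_iff D y).1 h⟩
    · obtain rfl : y = D.zero := hy
      exact .inr ⟨rfl, (C.prod_isOneDim_zero_right_iff D x).1 h⟩
  · rintro (⟨hx, h⟩ | ⟨hy, h⟩)
    · obtain rfl : x = C.zero := hx
      exact (C.prod_isOneDim_zero_left_iff D y).2 h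
    · obtain rfl : y = D.zero := hy
      exact (C.prod_isOneDim_zero_right_iff D x).2 h

theorem sumList_nil_iff (C : COSEA E) (s : E) : C.SumList [] s ↔ s = C.zero :=
  ⟨fun h => by cases h; rfl, fun h => h ▸ .nil⟩

theorem sumList_cons_iff (C : COSEA E) (a : E) (l : List E) (s : E) :
    C.SumList (a :: l) s ↔ ∃ t, C.SumList l t ∧ C.perp a t ∧ s = C.oplus a t := by
  constructor
  · intro h
    cases h with
    | cons h hp => exact ⟨_, h, hp, rfl⟩
  · rintro ⟨t, h, hp, rfl⟩
    exact .cons h hp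

theorem prod_sumList_iff (C : COSEA E) (D : COSEA F) (l : List (E × F)) (s : E × F) :
    (C.prod D).SumList l s ↔ C.SumList (l.map Prod.fst) s.1 ∧ D.SumList (l.map Prod.snd) s.2 := by
  induction l generalizing s with
  | nil =>
    simp only [List.map_nil, sumList_nil_iff]
    exact Prod.ext_iff
  | cons a l ih =>
    simp only [List.map_cons, sumList_cons_iff]
    constructor
    · rintro ⟨t, h, hp, rfl⟩
      exact ⟨⟨t.1, ((ih t).1 h).1, hp.1, rfl⟩, ⟨t.2, ((ih t).1 h).2, hp.2, rfl⟩⟩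
    · rintro ⟨⟨t, h, hp, hs⟩, ⟨t', h', hp', hs'⟩⟩
      exact ⟨(t, t'), (ih _).2 ⟨h, h'⟩, ⟨hp, hp'⟩, Prod.ext hs hs'⟩

open Classical in
theorem sumList_filter_ne_zero_iff (C : COSEA E) (l : List E) (s : E) :
    C.SumList (l.filter (· ≠ C.zero)) s ↔ C.SumList l s := by
  induction l generalizing s with
  | nil => simp
  | cons a l ih =>
    by_cases ha : a = C.zero
    · simpa [ha, sumList_cons_iff, C.zero_perp, C.zero_oplus] using ih s
    · simp [ha, ← ih, sumList_cons_iff]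

theorem isContext_iff_exists_list (C : COSEA E) (A : Set E) :
    C.IsContext A ↔ ∃ l : List E, l.Nodup ∧ (∀ x ∈ l, C.IsOneDim x) ∧ C.SumList l C.one ∧
      {x | x ∈ l} = A := by
  constructor
  · rintro ⟨n, a, ⟨hi, h1, hs⟩, rfl⟩
    refine ⟨List.ofFn a, List.nodup_ofFn.2 hi, ?_, hs, ?_⟩
    · simpa [List.mem_ofFn] using h1
    · ext x
      simp [List.mem_ofFn]
  · rintro ⟨l, hn, h1, hs, rfl⟩
    refine ⟨l.length, l.get, ⟨List.nodup_iff_injective_get.1 hn, fun i => h1 _ (l.get_mem i), ?_⟩,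
      Set.range_list_get l⟩
    rwa [List.ofFn_get]

open Classical in
theorem prod_isContext_iff (C : COSEA E) (D : COSEA F) (A : Set (E × F)) :
    (C.prod D).IsContext A ↔
      ∃ (A1 : Set E) (A2 : Set F), C.IsContext A1 ∧ D.IsContext A2 ∧
        A = (fun x => (x, D.zero)) '' A1 ∪ (fun y => (C.zero, y)) '' A2 := by
  simp only [isContext_iff_exists_list]
  constructor
  · rintro ⟨l, hn, h1, hs, rfl⟩
    obtain ⟨hs1, hs2⟩ := (C.prod_sumList_iff D _ _).1 hs
    have hl : ∀ x ∈ l, (x.1 = C.zero ∧ D.IsOneDim x.2) ∨ (x.2 = D.zero ∧ C.IsOneDim x.1) :=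
      fun x hx => (C.prod_isOneDim_iff D x).1 (h1 x hx)
    refine ⟨_, _, ⟨(l.map Prod.fst).filter (· ≠ C.zero), ?_, ?_,
      (C.sumList_filter_ne_zero_iff _ _).2 hs1, rfl⟩,
      ⟨(l.map Prod.snd).filter (· ≠ D.zero), ?_, ?_,
      (D.sumList_filter_ne_zero_iff _ _).2 hs2, rfl⟩, ?_⟩
    · rw [List.filter_map]
      refine (hn.filter _).map_on fun x hx y hy hxy => ?_
      simp only [List.mem_filter, Function.comp_apply, decide_eq_true_eq] at hx hy
      have hx' := ((hl x hx.1).resolve_left fun h => hx.2 h.1).1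
      have hy' := ((hl y hy.1).resolve_left fun h => hy.2 h.1).1
      exact Prod.ext hxy (hx'.trans hy'.symm)
    · intro x hx
      simp only [List.mem_filter, List.mem_map, decide_eq_true_eq] at hx
      obtain ⟨⟨p, hp, rfl⟩, hne⟩ := hx
      exact ((hl p hp).resolve_left fun h => hne h.1).2
    · rw [List.filter_map]
      refine (hn.filter _).map_on fun x hx y hy hxy => ?_
      simp only [List.mem_filter, Function.comp_apply, decide_eq_true_eq] at hx hy
      have hx' := ((hl x hx.1).resolve_right fun h => hx.2 h.1).1
      have hy' := ((hl y hy.1).resolve_right fun h => hy.2 h.1).1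
      exact Prod.ext (hx'.trans hy'.symm) hxy
    · intro x hx
      simp only [List.mem_filter, List.mem_map, decide_eq_true_eq] at hx
      obtain ⟨⟨p, hp, rfl⟩, hne⟩ := hx
      exact ((hl p hp).resolve_right fun h => hne h.1).2
    · ext p
      simp only [Set.mem_ofPred_eq, Set.mem_union, Set.mem_image, List.mem_filter, List.mem_map,
        decide_eq_true_eq]
      constructor
      · intro hp
        rcases hl p hp with ⟨h0, h⟩ | ⟨h0, h⟩
        · exact .inr ⟨p.2, ⟨⟨p, hp, rfl⟩, h.2.1⟩, Prod.ext h0.symm rfl⟩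
        · exact .inl ⟨p.1, ⟨⟨p, hp, rfl⟩, h.2.1⟩, Prod.ext rfl h0.symm⟩
      · rintro (⟨_, ⟨⟨q, hq, rfl⟩, hne⟩, rfl⟩ | ⟨_, ⟨⟨q, hq, rfl⟩, hne⟩, rfl⟩)
        · rwa [← ((hl q hq).resolve_left fun h => hne h.1).1]
        · rwa [← ((hl q hq).resolve_right fun h => hne h.1).1]
  · rintro ⟨_, _, ⟨l, hn, h1, hs, rfl⟩, ⟨m, hn', h1', hs', rfl⟩, rfl⟩
    have hl : l.filter (· ≠ C.zero) = l :=
      List.filter_eq_self.2 fun x hx => decide_eq_true (h1 x hx).2.1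
    have hm : m.filter (· ≠ D.zero) = m :=
      List.filter_eq_self.2 fun x hx => decide_eq_true (h1' x hx).2.1
    refine ⟨l.map (fun x => (x, D.zero)) ++ m.map (fun y => (C.zero, y)), ?_, ?_, ?_, ?_⟩
    · refine (hn.map fun x y h => congrArg Prod.fst h).append
        (hn'.map fun x y h => congrArg Prod.snd h) fun p hp hp' => ?_
      obtain ⟨x, hx, rfl⟩ := List.mem_map.1 hp
      obtain ⟨y, -, hy⟩ := List.mem_map.1 hp'
      exact (h1 x hx).2.1 (congrArg Prod.fst hy).symm
    · intro p hp
      rcases List.mem_append.1 hp with hp | hp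
      · obtain ⟨x, hx, rfl⟩ := List.mem_map.1 hp
        exact (C.prod_isOneDim_zero_right_iff D x).2 (h1 x hx)
      · obtain ⟨y, hy, rfl⟩ := List.mem_map.1 hp
        exact (C.prod_isOneDim_zero_left_iff D y).2 (h1' y hy)
    · refine (C.prod_sumList_iff D _ _).2 ⟨?_, ?_⟩
      · rw [← sumList_filter_ne_zero_iff, List.map_append, List.filter_append, List.map_map,
          List.map_map]
        change C.SumList _ C.one
        convert hs
        simpa [Function.comp_def] using hl
      · rw [← sumList_filter_ne_zero_iff, List.map_append, List.filter_append, List.map_map,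
          List.map_map]
        change D.SumList _ D.one
        convert hs'
        simpa [Function.comp_def] using hm
    · ext p
      simp [List.mem_append, List.mem_map]

end COSEA

/-- one-dimensional elements and contexts of a direct sum. -/
theorem direct_sum_oneDim_and_contexts {E1 E2 : Type u}
    (C1 : COSEA E1) (C2 : COSEA E2) :
    (∀ a : E1 × E2, (C1.prod C2).IsOneDim a ↔
      (a.1 = C1.zero ∧ C2.IsOneDim a.2) ∨ (a.2 = C2.zero ∧ C1.IsOneDim a.1)) ∧
    (∀ A : Set (E1 × E2), (C1.prod C2).IsContext A ↔
      ∃ (A1 : Set E1) (A2 : Set E2), C1.IsContext A1 ∧ C2.IsContext A2 ∧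
        A = (fun x => (x, C2.zero)) '' A1 ∪ (fun y => (C1.zero, y)) '' A2) := by
  exact ⟨C1.prod_isOneDim_iff C2, C1.prod_isContext_iff C2⟩
end
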